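/- arXiv:2004.00557 — 4 statements merged into one kernel-verified Lean document; each statement's English description precedes it below -/
import Mathlib

section
/- Let X be a type, let C be a set of functions X → {−1,1}, and let S ⊆ X be a finite set with |S| = 2^k that is shattered by C, i.e., for every subset T ⊆ S there exists f ∈ C with f(x) = −1 if and only if x ∈ T, for all x ∈ S. Then there exist 2^k distinct functions f_1, …, f_{2^k} ∈ C such that, under the uniform probability measure on S, (1/|S|)·Σ_{x∈S} f_i(x)·f_j(x) = 0 for all i ≠ j. -/
/-- The entry at `(a, b)` of the Sylvester–Hadamard matrix: the parity `(-1) ^ ⟨a, b⟩`. -/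
def paritySign {ι : Type*} [Fintype ι] (a b : ι → Bool) : ℝ :=
  ∏ i, if a i && b i then -1 else 1

theorem paritySign_eq_one_or_eq_neg_one {ι : Type*} [Fintype ι] (a b : ι → Bool) :
    paritySign a b = 1 ∨ paritySign a b = -1 := by
  unfold paritySign
  refine Finset.prod_induction _ (fun y : ℝ => y = 1 ∨ y = -1) ?_ (Or.inl rfl) ?_
  · rintro x y (rfl | rfl) (rfl | rfl) <;> norm_num
  · intro i _
    split_ifs <;> simp

theorem sum_paritySign_mul_paritySign_eq_zero {ι : Type*} [Fintype ι] [DecidableEq ι]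
    {a a' : ι → Bool} (h : a ≠ a') : ∑ b, paritySign a b * paritySign a' b = 0 := by
  obtain ⟨i, hi⟩ := Function.ne_iff.mp h
  simp only [paritySign, ← Finset.prod_mul_distrib]
  rw [← Fintype.prod_sum (fun i c =>
    (if a i && c then (-1 : ℝ) else 1) * (if a' i && c then -1 else 1))]
  refine Finset.prod_eq_zero (Finset.mem_univ i) ?_
  cases ha : a i <;> cases ha' : a' i <;> simp_all

/-- **A shattered set of size `2^k` yields `2^k` pairwise-orthogonal functions.**
If a class `C` of `{-1,1}`-valued functions shatters a finite set `S` of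
cardinality `2^k`, then `C` contains `2^k` distinct functions that are pairwise
orthogonal under the uniform measure on `S`. -/
theorem shattered_set_gives_orthogonal_family
    {X : Type*} (C : Set (X → ℝ)) (k : ℕ)
    (hCval : ∀ f ∈ C, ∀ x, f x = 1 ∨ f x = -1)
    (S : Finset X) (hScard : S.card = 2 ^ k)
    (hshatter : ∀ T ⊆ S, ∃ f ∈ C, ∀ x ∈ S, (f x = -1 ↔ x ∈ T)) :
    ∃ g : Fin (2 ^ k) → X → ℝ,
      Function.Injective g ∧ (∀ i, g i ∈ C) ∧
      ∀ i j, i ≠ j → (1 / (S.card : ℝ)) * ∑ x ∈ S, g i x * g j x = 0 := by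
  classical
  let points : S ≃ (Fin k → Bool) := Fintype.equivOfCardEq (by simp [hScard])
  let labels : Fin (2 ^ k) ≃ (Fin k → Bool) := Fintype.equivOfCardEq (by simp)
  have realize (a : Fin k → Bool) : ∃ f ∈ C, ∀ x : S, f x = paritySign a (points x) := by
    obtain ⟨f, hfC, hf⟩ := hshatter
      ((S.attach.filter fun x => paritySign a (points x) = -1).map
        (Function.Embedding.subtype _)) (by
          intro x hx
          obtain ⟨y, -, rfl⟩ := Finset.mem_map.mp hx
          exact y.2)
    refine ⟨f, hfC, fun x => ?_⟩
    have hx : f x = -1 ↔ paritySign a (points x) = -1 := by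
      rw [hf x x.2]
      simp
    rcases hCval f hfC x with h | h <;>
      rcases paritySign_eq_one_or_eq_neg_one a (points x) with h' | h' <;>
      rw [h, h'] at hx ⊢ <;> norm_num at hx
  choose f hfC hf using realize
  have orthogonal (i j : Fin (2 ^ k)) (hij : i ≠ j) :
      ∑ x ∈ S, f (labels i) x * f (labels j) x = 0 := by
    rw [← Finset.sum_coe_sort S fun x => f (labels i) x * f (labels j) x]
    simp only [hf]
    rw [points.sum_comp fun b => paritySign (labels i) b * paritySign (labels j) b]
    exact sum_paritySign_mul_paritySign_eq_zero (labels.injective.ne hij)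
  refine ⟨fun i => f (labels i), fun i j hij => ?_, fun i => hfC _, fun i j hij => by
    rw [orthogonal i j hij, mul_zero]⟩
  by_contra hne
  have hsum := orthogonal i j hne
  rw [← show f (labels i) = f (labels j) from hij,
    Finset.sum_congr rfl (g := fun _ => (1 : ℝ)) fun x _ => by
      rcases hCval _ (hfC (labels i)) x with h | h <;> simp [h]] at hsum
  simp [hScard] at hsum
end

section
/- Let μ be a probability measure on a measurable space X, let c : X → {−1,1} be measurable, let 0 ≤ η < 1/2, and let q : X × {−1,1} → {0,1} be measurable. Define the 'noisy part' N = {x ∈ X : q(x,1) ≠ q(x,−1)} and its complement N^c = {x : q(x,1) = q(x,−1)}. Let ν be the Bernoulli measure on {0,1} with ν({1}) = η, and write ℓ(x,b) = (−1)^b · c(x) for the noisy label. Then ∫_X q(x, c(x)) dμ(x) = ( ∫ 1_N(x)·q(x, ℓ(x,b)) d(μ ⊗ ν)(x,b) − η·μ(N) ) / (1 − 2η) + ∫ 1_{N^c}(x)·q(x, ℓ(x,b)) d(μ ⊗ ν)(x,b). -/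
open MeasureTheory

/-- Integration against the product of `μ` with the Bernoulli measure on `Bool` of parameter `η`. -/
theorem integral_prod_bernoulli {X : Type*} [MeasurableSpace X] (μ : Measure X) [IsFiniteMeasure μ]
    {η : ℝ} (hη0 : 0 ≤ η) (hη1 : η ≤ 1) {f : X × Bool → ℝ} (hf : Measurable f)
    {C : ℝ} (hC : ∀ p, ‖f p‖ ≤ C) :
    ∫ p, f p ∂(μ.prod (ENNReal.ofReal η • Measure.dirac true
      + ENNReal.ofReal (1 - η) • Measure.dirac false)) =
      η * ∫ x, f (x, true) ∂μ + (1 - η) * ∫ x, f (x, false) ∂μ := by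
  have : IsFiniteMeasure (ENNReal.ofReal η • Measure.dirac true : Measure Bool) :=
    Measure.smul_finite _ ENNReal.ofReal_ne_top
  have : IsFiniteMeasure (ENNReal.ofReal (1 - η) • Measure.dirac false : Measure Bool) :=
    Measure.smul_finite _ ENNReal.ofReal_ne_top
  have hint (b : Bool) : Integrable (fun x => f (x, b)) μ :=
    .of_bound (hf.comp measurable_prodMk_right).aestronglyMeasurable C
      (.of_forall fun x => hC (x, b))
  rw [integral_prod _ (.of_bound hf.aestronglyMeasurable C (.of_forall hC)),
    ← integral_const_mul, ← integral_const_mul,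
    ← integral_add ((hint true).const_mul η) ((hint false).const_mul (1 - η))]
  refine integral_congr_ae (.of_forall fun x => ?_)
  simp only
  rw [integral_add_measure .of_finite .of_finite, integral_smul_measure, integral_smul_measure,
    integral_dirac, integral_dirac, ENNReal.toReal_ofReal hη0,
    ENNReal.toReal_ofReal (sub_nonneg.2 hη1), smul_eq_mul, smul_eq_mul]

open scoped Classical in
/-- **Kearns' noise-correction formula.**  For a `{0,1}`-valued query `q`, split
the domain into the noisy part `N = {x : q(x,1) ≠ q(x,−1)}` and its complement.
Writing `ℓ(x,b) = (−1)^b·c(x)` for the noisy label (where the flip bit `b` is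
Bernoulli with parameter `η < 1/2`), the clean expectation `E_μ[q(x,c(x))]`
equals the expectation on the noisy part un-noised by subtracting `η·μ(N)` and
dividing by `1 − 2η`, plus the expectation on the clean part. -/
theorem kearns_noise_correction
    {X : Type*} [MeasurableSpace X] (μ : Measure X) [IsProbabilityMeasure μ]
    (c : X → ℝ) (hc : Measurable c) (hcval : ∀ x, c x = 1 ∨ c x = -1)
    (η : ℝ) (hη0 : 0 ≤ η) (hη : η < 1 / 2)
    (q : X → ℝ → ℝ) (hq : Measurable fun p : X × ℝ => q p.1 p.2)
    (hqval : ∀ x y, q x y = 0 ∨ q x y = 1) :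
    let N : Set X := {x | q x 1 ≠ q x (-1)}
    let ν : Measure Bool :=
      ENNReal.ofReal η • Measure.dirac true + ENNReal.ofReal (1 - η) • Measure.dirac false
    let ℓ : X → Bool → ℝ := fun x b => if b then -c x else c x
    ∫ x, q x (c x) ∂μ =
      ((∫ p : X × Bool, (if p.1 ∈ N then q p.1 (ℓ p.1 p.2) else 0) ∂(μ.prod ν))
          - η * (μ N).toReal) / (1 - 2 * η)
        + ∫ p : X × Bool, (if p.1 ∈ N then 0 else q p.1 (ℓ p.1 p.2)) ∂(μ.prod ν) := by
  intro N ν ℓ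
  have hq_comp {Y : Type _} [MeasurableSpace Y] {g : Y → X} {h : Y → ℝ} (hg : Measurable g)
      (hh : Measurable h) : Measurable fun y => q (g y) (h y) := hq.comp (hg.prodMk hh)
  have hN : MeasurableSet N :=
    (measurableSet_eq_fun (hq_comp measurable_id measurable_const)
      (hq_comp measurable_id measurable_const)).compl
  have hℓ : Measurable fun p : X × Bool => ℓ p.1 p.2 :=
    Measurable.ite (measurable_snd (measurableSet_singleton true))
      (hc.comp measurable_fst).neg (hc.comp measurable_fst)
  have hqℓ : Measurable fun p : X × Bool => q p.1 (ℓ p.1 p.2) := hq_comp measurable_fst hℓ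
  have hq_norm (x : X) (y : ℝ) : |q x y| ≤ 1 := by
    rcases hqval x y with h | h <;> simp [h]
  have hη1 : η ≤ 1 := by linarith
  have hqc : Measurable fun x => q x (c x) := hq_comp measurable_id hc
  have hnoisy : Integrable (fun x => if x ∈ N then q x (c x) else 0) μ :=
    .of_bound (hqc.ite hN measurable_const).aestronglyMeasurable 1
      (.of_forall fun x => by split_ifs <;> simp [hq_norm])
  have hclean : Integrable (fun x => if x ∈ N then 0 else q x (c x)) μ :=
    .of_bound (measurable_const.ite hN hqc).aestronglyMeasurable 1
      (.of_forall fun x => by split_ifs <;> simp [hq_norm])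
  have hind : Integrable (N.indicator fun _ => (1 : ℝ)) μ :=
    (integrable_const 1).indicator hN
  have hsplit : ∫ x, q x (c x) ∂μ =
      ∫ x, (if x ∈ N then q x (c x) else 0) ∂μ + ∫ x, (if x ∈ N then 0 else q x (c x)) ∂μ := by
    rw [← integral_add hnoisy hclean]
    exact integral_congr_ae (.of_forall fun x => by by_cases h : x ∈ N <;> simp [h])
  have hflip_noisy : ∫ x, (if x ∈ N then q x (-c x) else 0) ∂μ =
      (μ N).toReal - ∫ x, (if x ∈ N then q x (c x) else 0) ∂μ := by
    have hμN : (μ N).toReal = ∫ x, N.indicator (fun _ => (1 : ℝ)) x ∂μ := by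
      simp [integral_indicator hN, measureReal_def]
    rw [hμN, ← integral_sub hind hnoisy]
    refine integral_congr_ae (.of_forall fun x => ?_)
    by_cases h : x ∈ N
    · have h' : q x 1 ≠ q x (-1) := h
      rcases hcval x with e | e <;> rcases hqval x 1 with h1 | h1 <;>
        rcases hqval x (-1) with h2 | h2 <;> simp_all
    · simp [h]
  have hflip_clean : ∫ x, (if x ∈ N then 0 else q x (-c x)) ∂μ =
      ∫ x, (if x ∈ N then 0 else q x (c x)) ∂μ := by
    refine integral_congr_ae (.of_forall fun x => ?_)
    by_cases h : x ∈ N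
    · simp [h]
    · have h' : q x 1 = q x (-1) := not_not.1 h
      rcases hcval x with e | e <;> simp [h, e, h']
  have hN' : MeasurableSet {p : X × Bool | p.1 ∈ N} := measurable_fst hN
  rw [integral_prod_bernoulli μ hη0 hη1 (hqℓ.ite hN' measurable_const) (C := 1)
      (fun p => by split_ifs <;> simp [hq_norm]),
    integral_prod_bernoulli μ hη0 hη1 (measurable_const.ite hN' hqℓ) (C := 1)
      (fun p => by split_ifs <;> simp [hq_norm])]
  simp only [ℓ, if_true, Bool.false_eq_true, if_false]
  rw [hsplit, hflip_noisy, hflip_clean]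
  set A := ∫ x, (if x ∈ N then q x (c x) else 0) ∂μ
  have hη_ne : 1 - 2 * η ≠ 0 := by linarith
  have hA : A = (η * ((μ N).toReal - A) + (1 - η) * A - η * (μ N).toReal) / (1 - 2 * η) := by
    rw [eq_div_iff hη_ne]
    ring
  rw [← hA]
  ring
end

section
/- Let α > 0 and let n be a positive integer. For a ∈ ℝ, let μ_a be the probability measure on ℝ with density z ↦ (αn/2)·exp(−αn·|z − a|) with respect to Lebesgue measure (the Laplace mechanism output on an input with true average a). Then for all a, a' ∈ ℝ with |a − a'| ≤ 1/n and every measurable set Z ⊆ ℝ, μ_a(Z) ≤ e^α · μ_{a'}(Z). In particular, since the averages of two datasets of n numbers in [0,1] that differ in a single entry differ by at most 1/n, the Laplace mechanism for releasing an average satisfies α-differential privacy. -/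
open MeasureTheory

/-- The output distribution of the Laplace mechanism on an input with true
average `a`: the measure on `ℝ` with density `z ↦ (αn/2)·exp(−αn·|z − a|)`
with respect to Lebesgue measure. -/
noncomputable def laplaceMechanism (α : ℝ) (n : ℕ) (a : ℝ) : Measure ℝ :=
  volume.withDensity fun z =>
    ENNReal.ofReal ((α * n / 2) * Real.exp (-(α * n * |z - a|)))

/-- Moving the true average by at most `1/n` changes the output distribution of the Laplace
mechanism by a factor of at most `e^α`. -/
theorem laplaceMechanism_apply_le {α : ℝ} (hα : 0 ≤ α) {n : ℕ} {a a' : ℝ}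
    (h : |a - a'| ≤ 1 / (n : ℝ)) {Z : Set ℝ} (hZ : MeasurableSet Z) :
    laplaceMechanism α n a Z ≤ ENNReal.ofReal (Real.exp α) * laplaceMechanism α n a' Z := by
  unfold laplaceMechanism
  rw [withDensity_apply _ hZ, withDensity_apply _ hZ, ← lintegral_const_mul _ (by fun_prop)]
  refine lintegral_mono fun z => ?_
  rw [← ENNReal.ofReal_mul (Real.exp_pos α).le, mul_left_comm, ← Real.exp_add]
  gcongr
  have hshift : |z - a'| ≤ |z - a| + |a - a'| := abs_sub_le z a a'
  have hsens : n * |a - a'| ≤ 1 := by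
    calc (n : ℝ) * |a - a'| ≤ n * (1 / n) := by gcongr
      _ ≤ 1 := by simpa using mul_inv_le_one
  have := mul_le_mul_of_nonneg_left hshift (by positivity : 0 ≤ α * n)
  have := mul_le_mul_of_nonneg_left hsens hα
  linarith

/-- The average of `n` numbers in `[0,1]` has sensitivity at most `1/n`. -/
theorem abs_average_sub_average_le {n : ℕ} {s s' : Fin n → ℝ}
    (hs : ∀ i, s i ∈ Set.Icc (0 : ℝ) 1) (hs' : ∀ i, s' i ∈ Set.Icc (0 : ℝ) 1)
    (h : ∃ i₀, ∀ i, i ≠ i₀ → s i = s' i) :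
    |(∑ i, s i) / n - (∑ i, s' i) / n| ≤ 1 / (n : ℝ) := by
  obtain ⟨i₀, h⟩ := h
  rw [← sub_div, ← Finset.sum_sub_distrib,
    Finset.sum_eq_single_of_mem i₀ (Finset.mem_univ _) fun i _ hi => sub_eq_zero.mpr (h i hi),
    abs_div, Nat.abs_cast]
  gcongr
  have h₁ := hs i₀
  have h₂ := hs' i₀
  exact abs_sub_le_iff.mpr ⟨by linarith [h₁.2, h₂.1], by linarith [h₁.1, h₂.2]⟩

/-- **The Laplace mechanism is `α`-differentially private** (Dwork–McSherry–
Nissim–Smith).  If `|a − a'| ≤ 1/n` then `μ_a(Z) ≤ e^α·μ_{a'}(Z)` for every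
measurable `Z`; in particular, since the averages of two datasets of `n` numbers
in `[0,1]` differing in a single entry differ by at most `1/n`, the Laplace
mechanism for releasing an average satisfies `α`-differential privacy. -/
theorem laplaceMechanism_differential_privacy (α : ℝ) (hα : 0 < α) (n : ℕ) (hn : 0 < n) :
    (∀ a a' : ℝ, |a - a'| ≤ 1 / (n : ℝ) → ∀ Z : Set ℝ, MeasurableSet Z →
      laplaceMechanism α n a Z ≤ ENNReal.ofReal (Real.exp α) * laplaceMechanism α n a' Z) ∧
    (∀ s s' : Fin n → ℝ,
      (∀ i, s i ∈ Set.Icc (0 : ℝ) 1) → (∀ i, s' i ∈ Set.Icc (0 : ℝ) 1) →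
      (∃ i₀, ∀ i, i ≠ i₀ → s i = s' i) →
      ∀ Z : Set ℝ, MeasurableSet Z →
        laplaceMechanism α n ((∑ i, s i) / n) Z ≤
          ENNReal.ofReal (Real.exp α) * laplaceMechanism α n ((∑ i, s' i) / n) Z) :=
  ⟨fun _ _ h _ hZ => laplaceMechanism_apply_le hα.le h hZ,
    fun _ _ hs hs' h _ hZ =>
      laplaceMechanism_apply_le hα.le (abs_average_sub_average_le hs hs' h) hZ⟩
end

section
/- Let n ≥ 1 and let U be the uniform probability measure on {0,1} × {0,1}^n. For c ∈ {0,1}^n define f_c : {0,1} × {0,1}^n → {−1,1} by f_c(b, x) = 1 if b = 1 and f_c(b, x) = (−1)^{c·x} if b = 0. Then ⟨f_c, f_c⟩_U = 1 for every c, and for all distinct c, c' ∈ {0,1}^n, ⟨f_c, f_{c'}⟩_U = 1/2. In particular, the 2^n functions {f_c} have all pairwise correlations equal to 1/2 ≤ 9/10 and all pairwise differences of correlations equal to 0 ≤ 1/2^n, so they witness that the strong statistical query dimension SSQ-DIM_U({f_c}, 9/10) equals 2^n. -/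
open MeasureTheory

/-- The uniform probability measure on `{0,1} × {0,1}^n`. -/
noncomputable def uniformAugCube (n : ℕ) : Measure (Bool × (Fin n → Bool)) :=
  (PMF.uniformOfFintype (Bool × (Fin n → Bool))).toMeasure

/-- The function `f_c(b,x)` which is `1` if `b = 1` and the parity
`(−1)^{c·x}` if `b = 0`. -/
def orParity {n : ℕ} (c : Fin n → Bool) (p : Bool × (Fin n → Bool)) : ℝ :=
  if p.1 then 1 else (-1) ^ (Finset.univ.filter fun i => c i && p.2 i).card

theorem orParity_true {n : ℕ} (c x : Fin n → Bool) : orParity c (true, x) = 1 := by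
  simp [orParity]

theorem orParity_false_eq_prod {n : ℕ} (c x : Fin n → Bool) :
    orParity c (false, x) = ∏ i, if c i && x i then (-1 : ℝ) else 1 := by
  simp [orParity, Finset.prod_ite]

theorem orParity_mul_self {n : ℕ} (c : Fin n → Bool) (p : Bool × (Fin n → Bool)) :
    orParity c p * orParity c p = 1 := by
  unfold orParity
  split_ifs
  · simp
  · rw [← mul_pow]
    simp

/-- Distinct parities are orthogonal on the cube. -/
theorem sum_orParity_false_mul_eq_zero {n : ℕ} {c c' : Fin n → Bool} (h : c ≠ c') :
    ∑ x, orParity c (false, x) * orParity c' (false, x) = 0 := by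
  obtain ⟨i, hi⟩ := Function.ne_iff.mp h
  simp only [orParity_false_eq_prod, ← Finset.prod_mul_distrib]
  have key := Finset.prod_univ_sum (fun _ : Fin n => (Finset.univ : Finset Bool))
    (fun i b => (if c i && b then (-1 : ℝ) else 1) * if c' i && b then (-1 : ℝ) else 1)
  rw [Fintype.piFinset_univ] at key
  rw [← key]
  refine Finset.prod_eq_zero (Finset.mem_univ i) ?_
  cases hc : c i <;> cases hc' : c' i <;> simp_all

theorem integral_uniformAugCube {n : ℕ} (f : Bool × (Fin n → Bool) → ℝ) :
    ∫ p, f p ∂(uniformAugCube n) =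
      (2 * 2 ^ n : ℝ)⁻¹ * (∑ x, f (true, x) + ∑ x, f (false, x)) := by
  rw [uniformAugCube, PMF.integral_eq_sum]
  simp [← Finset.mul_sum, Fintype.sum_prod_type]

theorem integral_orParity_mul_self {n : ℕ} (c : Fin n → Bool) :
    ∫ p, orParity c p * orParity c p ∂(uniformAugCube n) = 1 := by
  simp only [orParity_mul_self, integral_uniformAugCube]
  simp only [mul_one, Finset.sum_const, Finset.card_univ, Fintype.card_fun, Fintype.card_fin,
    Fintype.card_bool, nsmul_eq_mul, Nat.cast_pow, Nat.cast_ofNat]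
  field_simp
  norm_num

theorem integral_orParity_mul_of_ne {n : ℕ} {c c' : Fin n → Bool} (h : c ≠ c') :
    ∫ p, orParity c p * orParity c' p ∂(uniformAugCube n) = 1 / 2 := by
  rw [integral_uniformAugCube, sum_orParity_false_mul_eq_zero h]
  simp only [orParity_true, mul_one, add_zero, Finset.sum_const, Finset.card_univ, Fintype.card_fun,
    Fintype.card_fin, Fintype.card_bool, nsmul_eq_mul, Nat.cast_pow, Nat.cast_ofNat]
  field_simp

/-- **A maximal gap between weak and strong SQ dimension.**  The `2^n` distinct
functions `f_c(b,x)` (equal to `1` when `b = 1` and to the parity `χ_c(x)` when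
`b = 0`) all have unit norm, and every pair of distinct functions has
correlation exactly `1/2` under the uniform distribution on
`{0,1} × {0,1}^n`. -/
theorem orParity_correlations (n : ℕ) (hn : 1 ≤ n) :
    Function.Injective (fun c : Fin n → Bool => orParity c) ∧
    (∀ c : Fin n → Bool,
      ∫ p, orParity c p * orParity c p ∂(uniformAugCube n) = 1) ∧
    (∀ c c' : Fin n → Bool, c ≠ c' →
      ∫ p, orParity c p * orParity c' p ∂(uniformAugCube n) = 1 / 2) := by
  refine ⟨fun c c' h => ?_, integral_orParity_mul_self, fun _ _ => integral_orParity_mul_of_ne⟩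
  by_contra hne
  have h_half := integral_orParity_mul_of_ne hne
  rw [← show orParity c = orParity c' from h, integral_orParity_mul_self] at h_half
  norm_num at h_half
end
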